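/- arXiv:2304.01790 — 2 statements merged into one kernel-verified Lean document; each statement's English description precedes it below -/
import Mathlib

section
/- Let G be a finite digraph on vertex set V, let X ⊆ V, and let v_1 ≠ v_2 be two vertices of X. Let t ∈ V be such that d_G(t → v_1) and d_G(t → v_2) are finite, set r = max( d_G(t → v_1), d_G(t → v_2) ), and suppose B⃗(t,r) ∩ X = {v_1, v_2}, where B⃗(w,ρ) = {u ∈ V : d_G(w → u) ≤ ρ}. Suppose moreover that r is minimal: for every t' ∈ V and ρ ∈ ℕ with B⃗(t',ρ) ∩ X = {v_1, v_2} one has ρ ≥ r. Then no vertex x ≠ t satisfies both d_G(t → x) + d_G(x → v_1) = d_G(t → v_1) and d_G(t → x) + d_G(x → v_2) = d_G(t → v_2); that is, the shortest directed paths from t to v_1 and from t to v_2 are internally vertex-disjoint. -/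
/-- A directed walk of length `n` from `u` to `v` in the digraph given by arcs `A`. -/
def DWalk {V : Type*} (A : V → V → Prop) (u v : V) (n : ℕ) : Prop :=
  ∃ f : Fin (n + 1) → V, f 0 = u ∧ f (Fin.last n) = v ∧
    ∀ i : Fin n, A (f i.castSucc) (f i.succ)

/-- Directed distance from `u` to `v` (`⊤` if unreachable). -/
noncomputable def ddist {V : Type*} (A : V → V → Prop) (u v : V) : ℕ∞ :=
  sInf {n : ℕ∞ | ∃ m : ℕ, n = m ∧ DWalk A u v m}

theorem dwalk_iff {V : Type*} (A : V → V → Prop) (u v : V) (n : ℕ) :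
    DWalk A u v n ↔ ∃ f : ℕ → V, f 0 = u ∧ f n = v ∧ ∀ i < n, A (f i) (f (i + 1)) := by
  constructor
  · rintro ⟨f, h0, hn, h⟩
    refine ⟨fun i => if hi : i < n + 1 then f ⟨i, hi⟩ else u, ?_, ?_, ?_⟩
    · simpa using h0
    · simp only [Nat.lt_succ_self, dif_pos]
      exact hn
    · intro i hi
      have h1 : i < n + 1 := by omega
      have h2 : i + 1 < n + 1 := by omega
      simp only [h1, h2, dif_pos]
      exact h ⟨i, hi⟩
  · rintro ⟨f, h0, hn, h⟩
    exact ⟨fun i => f i, by simpa using h0, by simpa using hn, fun i => by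
      simpa using h i i.2⟩

theorem dwalk_trans {V : Type*} {A : V → V → Prop} {u v w : V} {n m : ℕ}
    (h1 : DWalk A u v n) (h2 : DWalk A v w m) : DWalk A u w (n + m) := by
  rw [dwalk_iff] at *
  obtain ⟨f, f0, fn, hf⟩ := h1
  obtain ⟨g, g0, gm, hg⟩ := h2
  refine ⟨fun i => if i < n then f i else g (i - n), ?_, ?_, ?_⟩
  · by_cases hn : 0 < n
    · simpa [hn] using f0
    · have : n = 0 := by omega
      subst this
      simp [g0, ← fn, f0]
  · simpa using gm
  · intro i hi
    by_cases a : i + 1 < n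
    · have b : i < n := by omega
      simpa [a, b] using hf i b
    · by_cases b : i < n
      · have c : i + 1 = n := by omega
        have := hf i b
        rw [c, fn, ← g0] at this
        simpa [c, b] using this
      · have c : i + 1 - n = (i - n) + 1 := by omega
        simpa [a, b, c] using hg (i - n) (by omega)

theorem ddist_attained {V : Type*} {A : V → V → Prop} {u v : V} (h : ddist A u v ≠ ⊤) :
    ∃ m : ℕ, ddist A u v = m ∧ DWalk A u v m := by
  have hne : {n : ℕ∞ | ∃ m : ℕ, n = m ∧ DWalk A u v m}.Nonempty := by
    by_contra hc
    rw [Set.not_nonempty_iff_eq_empty] at hc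
    exact h (by rw [ddist, hc, sInf_empty])
  exact csInf_mem hne

theorem ddist_triangle {V : Type*} (A : V → V → Prop) (u v w : V) :
    ddist A u w ≤ ddist A u v + ddist A v w := by
  by_cases h1 : ddist A u v = ⊤
  · simp [h1]
  by_cases h2 : ddist A v w = ⊤
  · simp [h2]
  obtain ⟨n, hn, wn⟩ := ddist_attained h1
  obtain ⟨m, hm, wm⟩ := ddist_attained h2
  rw [hn, hm]
  exact sInf_le ⟨n + m, by simp, dwalk_trans wn wm⟩

/-- If the directed ball `B⃗(t,r)` with `r = max(d(t→v1), d(t→v2))` picks out exactly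
`{v1, v2}` from `X` and `r` is minimal with this property, then the shortest directed
paths from `t` to `v1` and from `t` to `v2` are internally vertex-disjoint. -/
theorem minimal_ball_paths_internally_disjoint {V : Type*} [Fintype V]
    (A : V → V → Prop) (X : Set V) (v1 v2 : V)
    (hv1 : v1 ∈ X) (hv2 : v2 ∈ X) (hne : v1 ≠ v2)
    (t : V) (hf1 : ddist A t v1 ≠ ⊤) (hf2 : ddist A t v2 ≠ ⊤)
    (r : ℕ) (hr : r = max (ddist A t v1).toNat (ddist A t v2).toNat)
    (hball : {u : V | ddist A t u ≤ (r : ℕ∞)} ∩ X = {v1, v2})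
    (hmin : ∀ (t' : V) (ρ : ℕ),
      {u : V | ddist A t' u ≤ (ρ : ℕ∞)} ∩ X = {v1, v2} → r ≤ ρ) :
    ∀ x : V, x ≠ t →
      ¬ (ddist A t x + ddist A x v1 = ddist A t v1 ∧
         ddist A t x + ddist A x v2 = ddist A t v2) := by
  rintro x hx ⟨e1, e2⟩
  have hk : ddist A t x ≠ ⊤ := fun h => hf1 (by rw [← e1, h, top_add])
  have ha : ddist A x v1 ≠ ⊤ := fun h => hf1 (by rw [← e1, h, add_top])
  have hb : ddist A x v2 ≠ ⊤ := fun h => hf2 (by rw [← e2, h, add_top])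
  obtain ⟨k, hk, wk⟩ := ddist_attained hk
  obtain ⟨a, ha, -⟩ := ddist_attained ha
  obtain ⟨b, hb, -⟩ := ddist_attained hb
  have hk0 : k ≠ 0 := by
    rintro rfl
    obtain ⟨f, h0, h1, -⟩ := wk
    exact hx (h1.symm.trans h0)
  rw [hk, ha] at e1
  rw [hk, hb] at e2
  have n1 : (ddist A t v1).toNat = k + a := by
    rw [← e1, ← Nat.cast_add, ENat.toNat_natCast]
  have n2 : (ddist A t v2).toNat = k + b := by
    rw [← e2, ← Nat.cast_add, ENat.toNat_natCast]
  rw [n1, n2] at hr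
  have := hmin x (r - k) (by
    apply Set.Subset.antisymm
    · rintro u ⟨hu, huX⟩
      rw [← hball]
      refine ⟨?_, huX⟩
      have hu' : ddist A x u ≤ ((r - k : ℕ) : ℕ∞) := hu
      calc ddist A t u ≤ ddist A t x + ddist A x u := ddist_triangle A t x u
        _ ≤ (k : ℕ∞) + ((r - k : ℕ) : ℕ∞) := by rw [hk]; gcongr
        _ = (r : ℕ∞) := by
          rw [← Nat.cast_add]
          congr 1
          omega
    · rintro u (rfl | rfl)
      · refine ⟨?_, hv1⟩
        change ddist A x u ≤ _
        rw [ha, Nat.cast_le]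
        omega
      · refine ⟨?_, hv2⟩
        change ddist A x u ≤ _
        rw [hb, Nat.cast_le]
        omega)
  omega
end

section
/- Let h ≥ 2 and let G = (V,E) be a finite unweighted K_h-minor-free simple graph. For v ∈ V and r ∈ ℕ let B(v,r) = {u ∈ V : d_G(v,u) ≤ r} be the ball of radius r centered at v (where d_G(v,u) = ∞ if u and v are in different components, so such u lies in no ball centered at v). Then the family {B(v,r) : v ∈ V, r ∈ ℕ} of subsets of V has VC dimension at most h−1; that is, every subset of V shattered by this family has at most h−1 elements. -/
/-- `G` contains a `K_h`-minor. -/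
def HasCliqueMinor {V : Type*} (G : SimpleGraph V) (h : ℕ) : Prop :=
  ∃ f : Fin h → Set V, (∀ i, (f i).Nonempty) ∧
    (∀ i j, i ≠ j → Disjoint (f i) (f j)) ∧
    (∀ i, (G.induce (f i)).Connected) ∧
    (∀ i j, i ≠ j → ∃ u ∈ f i, ∃ v ∈ f j, G.Adj u v)

/-- A family `F` shatters `Y`. -/
def Shatters {U : Type*} (F : Set (Set U)) (Y : Set U) : Prop :=
  ∀ Z ⊆ Y, ∃ S ∈ F, Z = S ∩ Y

/-- Voronoi cell with ties broken by smallest index. -/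
def vcell {V : Type*} (G : SimpleGraph V) {h : ℕ} (x : Fin h → V) (i : Fin h) : Set V :=
  {u | G.edist u (x i) ≠ ⊤ ∧ (∀ k, G.edist u (x i) ≤ G.edist u (x k)) ∧
    ∀ k, k < i → G.edist u (x i) < G.edist u (x k)}

theorem edist_descent {V : Type*} (G : SimpleGraph V) (u y : V) (n : ℕ)
    (hn : G.edist u y ≤ ((n + 1 : ℕ) : ℕ∞)) :
    u = y ∨ ∃ w, G.Adj u w ∧ G.edist w y ≤ (n : ℕ∞) := by
  have hne : G.edist u y ≠ ⊤ := ne_top_of_le_ne_top (ENat.natCast_ne_top _) hn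
  obtain ⟨p, hp⟩ := SimpleGraph.exists_walk_of_edist_ne_top hne
  cases p with
  | nil => exact Or.inl rfl
  | cons hadj q =>
    refine Or.inr ⟨_, hadj, (SimpleGraph.edist_le q).trans ?_⟩
    rw [← hp] at hn
    have : q.length + 1 ≤ n + 1 := by
      simpa only [SimpleGraph.Walk.length_cons, Nat.cast_le] using hn
    exact_mod_cast Nat.le_of_succ_le_succ this

theorem edist_adj_le {V : Type*} (G : SimpleGraph V) {u w : V} (hadj : G.Adj u w) (y : V) :
    G.edist u y ≤ G.edist w y + 1 := by
  have h1 := G.edist_triangle (u := u) (v := w) (w := y)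
  rw [SimpleGraph.edist_eq_one_iff_adj.2 hadj, add_comm] at h1
  exact h1

theorem self_mem_vcell {V : Type*} (G : SimpleGraph V) {h : ℕ} (x : Fin h → V)
    (hx : Function.Injective x) (i : Fin h) : x i ∈ vcell G x i := by
  refine ⟨by simp, by simp, fun k hk => ?_⟩
  rw [SimpleGraph.edist_self]
  exact SimpleGraph.edist_pos_of_ne (fun e => hk.ne' (hx e))

theorem vcell_disjoint {V : Type*} (G : SimpleGraph V) {h : ℕ} (x : Fin h → V)
    {i j : Fin h} (hij : i ≠ j) : Disjoint (vcell G x i) (vcell G x j) := by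
  rw [Set.disjoint_left]
  rintro u ⟨-, a, b⟩ ⟨-, c, d⟩
  rcases lt_or_gt_of_ne hij with hlt | hlt
  · exact absurd (a j) (not_le.2 (d i hlt))
  · exact absurd (c i) (not_le.2 (b j hlt))

theorem exists_vcell {V : Type*} (G : SimpleGraph V) {h : ℕ} (x : Fin h → V)
    (u : V) (i : Fin h) (hi : G.edist u (x i) ≠ ⊤) :
    ∃ m, u ∈ vcell G x m := by
  classical
  obtain ⟨m, -, hm⟩ := Finset.exists_min_image Finset.univ
    (fun k => toLex (G.edist u (x k), k)) ⟨i, Finset.mem_univ _⟩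
  have key : ∀ k, G.edist u (x m) < G.edist u (x k) ∨
      G.edist u (x m) = G.edist u (x k) ∧ m ≤ k := fun k => by
    have := hm k (Finset.mem_univ _)
    rwa [Prod.Lex.toLex_le_toLex] at this
  have hle : ∀ k, G.edist u (x m) ≤ G.edist u (x k) := fun k =>
    (key k).elim le_of_lt (fun e => e.1.le)
  exact ⟨m, ne_top_of_le_ne_top hi (hle i), hle, fun k hk =>
    (key k).elim id (fun e => absurd e.2 (not_le.2 hk))⟩

theorem vcell_reach {V : Type*} (G : SimpleGraph V) {h : ℕ} (x : Fin h → V)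
    (hx : Function.Injective x) (i : Fin h) (n : ℕ) :
    ∀ u (hu : u ∈ vcell G x i), G.edist u (x i) = (n : ℕ∞) →
      (G.induce (vcell G x i)).Reachable ⟨u, hu⟩ ⟨x i, self_mem_vcell G x hx i⟩ := by
  induction n with
  | zero =>
    intro u hu h0
    have : u = x i := by simpa using h0
    subst this
    exact SimpleGraph.Reachable.refl _
  | succ n ih =>
    intro u hu hn
    rcases edist_descent G u (x i) n hn.le with rfl | ⟨w, hadj, hw⟩
    · exact SimpleGraph.Reachable.refl _
    · have hw1 := edist_adj_le G hadj (x i)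
      have hweq : G.edist w (x i) = n := by
        refine le_antisymm hw ?_
        rw [hn] at hw1
        push_cast at hw1
        exact (ENat.add_le_add_iff_right (by simp)).1 hw1
      have hwc : w ∈ vcell G x i := by
        refine ⟨by rw [hweq]; exact ENat.natCast_ne_top _, fun k => ?_, fun k hk => ?_⟩
        · have h1 := (hu.2.1 k).trans (edist_adj_le G hadj (x k))
          rw [hn] at h1
          push_cast at h1
          rw [hweq]
          exact (ENat.add_le_add_iff_right (by simp)).1 h1
        · have h1 := (hu.2.2 k hk).trans_le (edist_adj_le G hadj (x k))
          rw [hn] at h1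
          push_cast at h1
          rw [hweq]
          exact lt_of_add_lt_add_right h1
      have ha : (G.induce (vcell G x i)).Adj ⟨u, hu⟩ ⟨w, hwc⟩ := hadj
      exact ha.reachable.trans (ih w hwc hweq)

theorem vcell_stay {V : Type*} (G : SimpleGraph V) {h : ℕ} (x : Fin h → V)
    (hx : Function.Injective x) (i j : Fin h)
    (hno : ∀ u ∈ vcell G x i, ∀ w ∈ vcell G x j, ¬ G.Adj u w) (n : ℕ) :
    ∀ u, G.edist u (x i) ≤ (n : ℕ∞) →
      (∀ k, k ≠ i → k ≠ j → (n : ℕ∞) < G.edist u (x k)) → u ∈ vcell G x i := by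
  induction n with
  | zero =>
    intro u h0 _
    have : u = x i := by simpa using h0
    subst this
    exact self_mem_vcell G x hx i
  | succ n ih =>
    intro u hn hk
    rcases edist_descent G u (x i) n hn with rfl | ⟨w, hadj, hw⟩
    · exact self_mem_vcell G x hx i
    · have hwi : w ∈ vcell G x i := by
        refine ih w hw fun k hki hkj => ?_
        have h1 := (hk k hki hkj).trans_le (edist_adj_le G hadj (x k))
        push_cast at h1
        exact lt_of_add_lt_add_right h1
      obtain ⟨m, hm⟩ := exists_vcell G x u i (ne_top_of_le_ne_top (ENat.natCast_ne_top _) hn)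
      by_cases hmi : m = i
      · exact hmi ▸ hm
      by_cases hmj : m = j
      · exact absurd hadj.symm (hno w hwi u (hmj ▸ hm))
      · exact absurd ((hm.2.1 i).trans hn) (not_le.2 (hk m hmi hmj))

theorem ball_iff {V : Type*} (G : SimpleGraph V) (v u : V) (r : ℕ) :
    (G.Reachable v u ∧ G.dist v u ≤ r) ↔ G.edist v u ≤ (r : ℕ∞) := by
  constructor
  · rintro ⟨h1, h2⟩
    rw [← h1.coe_dist_eq_edist]
    exact_mod_cast h2
  · intro h1
    have hr : G.Reachable v u := SimpleGraph.reachable_of_edist_ne_top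
      (ne_top_of_le_ne_top (ENat.natCast_ne_top _) h1)
    rw [← hr.coe_dist_eq_edist] at h1
    exact ⟨hr, by exact_mod_cast h1⟩

/-- The family of balls `B(v,r) = {u | d(v,u) ≤ r}` (vertices in other components lie in
no ball centered at `v`) in a `K_h`-minor-free graph has VC dimension at most `h − 1`. -/
theorem vc_dim_undirected_balls {V : Type*} [Fintype V] (h : ℕ) (hh : 2 ≤ h)
    (G : SimpleGraph V) (hminor : ¬ HasCliqueMinor G h)
    (Y : Set V)
    (hshat : Shatters
      {S : Set V | ∃ (v : V) (r : ℕ),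
        S = {u : V | G.Reachable v u ∧ G.dist v u ≤ r}} Y) :
    Y.encard ≤ (h - 1 : ℕ) := by
  by_contra hcon
  apply hminor
  have hle : (h : ℕ∞) ≤ Y.encard := by
    have h1 := Order.add_one_le_of_lt (not_le.1 hcon)
    have h2 : (((h - 1 : ℕ) : ℕ∞) + 1) = (h : ℕ∞) := by
      exact_mod_cast Nat.sub_add_cancel (by omega : 1 ≤ h)
    rwa [h2] at h1
  obtain ⟨T, hTY, hT⟩ := Set.exists_subset_encard_eq hle
  have hTf : T.Finite := Set.toFinite T
  have hTc : Nat.card T = h := by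
    rw [Nat.card_coe_set_eq, Set.ncard, hT]; simp
  let e : T ≃ Fin h := Finite.equivFinOfCardEq hTc
  let x : Fin h → V := fun i => (e.symm i : V)
  have hx : Function.Injective x := Subtype.val_injective.comp e.symm.injective
  have hxY : ∀ i, x i ∈ Y := fun i => hTY (e.symm i).2
  refine ⟨vcell G x, fun i => ⟨_, self_mem_vcell G x hx i⟩,
    fun i j hij => vcell_disjoint G x hij, fun i => ?_, fun i j hij => ?_⟩
  · rw [SimpleGraph.connected_iff_exists_forall_reachable]
    refine ⟨⟨x i, self_mem_vcell G x hx i⟩, fun ⟨u, hu⟩ => ?_⟩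
    obtain ⟨n, hn⟩ := ENat.ne_top_iff_exists.1 hu.1
    exact (vcell_reach G x hx i n u hu hn.symm).symm
  · by_contra hno
    push Not at hno
    obtain ⟨S, ⟨v, r, rfl⟩, hS⟩ := hshat {x i, x j} (by
      rintro _ (rfl | rfl)
      · exact hxY i
      · exact hxY j)
    have hball : ∀ k, G.edist v (x k) ≤ (r : ℕ∞) ↔ (k = i ∨ k = j) := fun k => by
      rw [← ball_iff]
      have := Set.ext_iff.1 hS (x k)
      simp only [Set.mem_insert_iff, Set.mem_singleton_iff, Set.mem_inter_iff,
        Set.mem_ofPred_eq, hxY k, and_true, hx.eq_iff] at this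
      exact this.symm
    have hout : ∀ k, k ≠ i → k ≠ j → (r : ℕ∞) < G.edist v (x k) := fun k h1 h2 =>
      not_le.1 fun h3 => ((hball k).1 h3).elim h1 h2
    have hvi := vcell_stay G x hx i j hno r v ((hball i).2 (Or.inl rfl)) hout
    have hvj := vcell_stay G x hx j i (fun u hu w hw hadj => hno w hw u hu hadj.symm) r v
      ((hball j).2 (Or.inr rfl)) (fun k h1 h2 => hout k h2 h1)
    exact Set.disjoint_left.1 (vcell_disjoint G x hij) hvi hvj
end
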